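/- Let 𝒪 ⊂ ℝ^{m−k} × ℝ^n be open, φ : 𝒪 → ℝᵏ, and A₀ ∈ 𝒪. Suppose there are an open set U ⊂ G with Φ(A₀) ∈ U and a map f = (f₁,…,f_k) ∈ C¹_G(U, ℝᵏ) such that graph(φ) ∩ U = {P ∈ U : f(P) = 0} and, for every Q ∈ U, the k×k matrix M₁(Q) := (X_i f_j(Q))_{j,i=1,…,k} is invertible. Then there is an open neighbourhood 𝒪' ⊂ 𝒪 of A₀ such that φ is uniformly intrinsically differentiable at every point of 𝒪', and for every A ∈ 𝒪' the matrix ∇^φφ(A) := −M₁(Φ(A))⁻¹·M₂(Φ(A)) satisfies the u.i.d. condition of φ at A, where M₂(Q) := (X_{k+i} f_j(Q))_{j=1,…,k; i=1,…,m−k}. -/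

import Mathlib

noncomputable section

open Set Filter Topology MeasureTheory

namespace Carnot

/-- Euclidean norm on `Fin d → ℝ`. -/
def enorm {d : ℕ} (x : Fin d → ℝ) : ℝ := Real.sqrt (∑ i, (x i) ^ 2)

/-- The underlying set of the Carnot group `G = ℝ^m × ℝ^n` of class `𝓑`. -/
abbrev G (m n : ℕ) := (Fin m → ℝ) × (Fin n → ℝ)

/-- Points of the normal complement `W`, identified with `ℝ^(m-k) × ℝ^n`. -/
abbrev W (m n k : ℕ) := (Fin (m - k) → ℝ) × (Fin n → ℝ)

/-- The group law of the Carnot group of class `𝓑` associated with the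
skew-symmetric matrices `b s`:
`(x,y)·(x',y') = (x + x', y + y' + ½⟨Bx,x'⟩)`. -/
def gmul {m n : ℕ} (b : Fin n → Matrix (Fin m) (Fin m) ℝ) (P Q : G m n) : G m n :=
  (P.1 + Q.1, fun s => P.2 s + Q.2 s + (1 / 2) * ∑ i, ∑ j, b s i j * P.1 j * Q.1 i)

/-- The group inverse `(x,y)⁻¹ = (-x,-y)`. -/
def ginv {m n : ℕ} (P : G m n) : G m n := (-P.1, -P.2)

/-- The homogeneous quasi-norm `N(x,y) = |x| + |y|^(1/2)`. -/
def qnorm {m n : ℕ} (P : G m n) : ℝ := enorm P.1 + Real.sqrt (enorm P.2)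

/-- Open ball for the quasi-norm: `U(P,r) = {Q : N(P⁻¹·Q) < r}`. -/
def ball (m n : ℕ) (b : Fin n → Matrix (Fin m) (Fin m) ℝ) (P : G m n) (r : ℝ) : Set (G m n) :=
  {Q | qnorm (gmul b (ginv P) Q) < r}

/-- The embedding `i : ℝ^(m-k) × ℝ^n → G`, `i(a,α) = (0,…,0,a,α)`. -/
def embW (m n k : ℕ) (A : W m n k) : G m n :=
  (fun j => if h : (j : ℕ) < k then 0 else A.1 ⟨(j : ℕ) - k, by have := j.isLt; omega⟩, A.2)

/-- The embedding of `ℝ^k` as the horizontal subgroup `H`, `v ↦ (v,0,…,0)`. -/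
def embH (m n k : ℕ) (v : Fin k → ℝ) : G m n :=
  (fun j => if h : (j : ℕ) < k then v ⟨(j : ℕ), h⟩ else 0, 0)

/-- The graph map `Φ(A) = i(A)·φ̂(A)`. -/
def graphMap (m n k : ℕ) (b : Fin n → Matrix (Fin m) (Fin m) ℝ)
    (φ : W m n k → Fin k → ℝ) (A : W m n k) : G m n :=
  gmul b (embW m n k A) (embH m n k (φ A))

/-- `N(i(A)⁻¹·i(B))`. -/
def dW (m n k : ℕ) (b : Fin n → Matrix (Fin m) (Fin m) ℝ) (A B : W m n k) : ℝ :=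
  qnorm (gmul b (ginv (embW m n k A)) (embW m n k B))

/-- The graph quasi-distance `σ_φ(A,B) = N(φ̂(A)⁻¹·i(A)⁻¹·i(B)·φ̂(A))`. -/
def sigma (m n k : ℕ) (b : Fin n → Matrix (Fin m) (Fin m) ℝ)
    (φ : W m n k → Fin k → ℝ) (A B : W m n k) : ℝ :=
  qnorm (gmul b (gmul b (gmul b (ginv (embH m n k (φ A))) (ginv (embW m n k A)))
    (embW m n k B)) (embH m n k (φ A)))

/-- The matrix `M` satisfies the uniform intrinsic differentiability condition of `φ`
at `A₀ ∈ 𝒪`. -/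
def UID (m n k : ℕ) (b : Fin n → Matrix (Fin m) (Fin m) ℝ) (O : Set (W m n k))
    (φ : W m n k → Fin k → ℝ) (A₀ : W m n k) (M : Matrix (Fin k) (Fin (m - k)) ℝ) : Prop :=
  ∀ ε > 0, ∃ r > 0, ∀ A ∈ O, ∀ B ∈ O,
    dW m n k b A₀ A < r → dW m n k b A B < r → 0 < dW m n k b A B →
    enorm (fun j => φ B j - φ A j - ∑ i, M j i * (B.1 i - A.1 i)) ≤ ε * sigma m n k b φ A B

/-- `f : U → ℝ^k` is of class `C¹_G` with (continuous) horizontal Jacobian `gradf`. -/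
def C1G (m n k : ℕ) (b : Fin n → Matrix (Fin m) (Fin m) ℝ) (U : Set (G m n))
    (f : G m n → Fin k → ℝ) (gradf : G m n → Matrix (Fin k) (Fin m) ℝ) : Prop :=
  ContinuousOn f U ∧ ContinuousOn gradf U ∧
  ∀ P ∈ U, ∀ ε > 0, ∃ r > 0, ∀ Q ∈ U,
    qnorm (gmul b (ginv P) Q) < r →
    enorm (fun j => f Q j - f P j - ∑ i, gradf P j i * (Q.1 i - P.1 i)) ≤
      ε * qnorm (gmul b (ginv P) Q)

/-- The square block `M₁(Q) = (X_i f_j(Q))_{j,i=1,…,k}` of the horizontal Jacobian. -/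
def M1 (m n k : ℕ) (hk : k ≤ m) (gradf : G m n → Matrix (Fin k) (Fin m) ℝ) (Q : G m n) :
    Matrix (Fin k) (Fin k) ℝ :=
  Matrix.of fun j i => gradf Q j (Fin.castLE hk i)

/-- The block `M₂(Q) = (X_{k+i} f_j(Q))_{j=1,…,k; i=1,…,m-k}` of the horizontal Jacobian. -/
def M2 (m n k : ℕ) (gradf : G m n → Matrix (Fin k) (Fin m) ℝ) (Q : G m n) :
    Matrix (Fin k) (Fin (m - k)) ℝ :=
  Matrix.of fun j i => gradf Q j ⟨k + (i : ℕ), by have := i.isLt; omega⟩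

section

variable {m n k : ℕ} {b : Fin n → Matrix (Fin m) (Fin m) ℝ}

lemma enorm_nonneg {d : ℕ} (x : Fin d → ℝ) : 0 ≤ enorm x := Real.sqrt_nonneg _

lemma norm_le_enorm {d : ℕ} (x : Fin d → ℝ) : ‖x‖ ≤ enorm x := by
  refine (pi_norm_le_iff_of_nonneg (enorm_nonneg x)).2 fun i => ?_
  rw [Real.norm_eq_abs]
  refine Real.abs_le_sqrt ?_
  exact Finset.single_le_sum (f := fun i => x i ^ 2) (fun i _ => sq_nonneg (x i))
    (Finset.mem_univ i)

lemma enorm_le_mul_norm {d : ℕ} (x : Fin d → ℝ) : enorm x ≤ d * ‖x‖ := by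
  refine Real.sqrt_le_iff.2 ⟨by positivity, ?_⟩
  have h : ∑ i, x i ^ 2 ≤ ∑ _i : Fin d, ‖x‖ ^ 2 := by
    refine Finset.sum_le_sum fun i _ => ?_
    rw [← sq_abs]
    exact pow_le_pow_left₀ (abs_nonneg _) (norm_le_pi_norm x i) 2
  rw [Finset.sum_const, Finset.card_univ, Fintype.card_fin, nsmul_eq_mul] at h
  refine h.trans ?_
  rw [mul_pow]
  gcongr
  exact_mod_cast Nat.le_self_pow two_ne_zero d

lemma enorm_smul {d : ℕ} (t : ℝ) (x : Fin d → ℝ) : enorm (t • x) = |t| * enorm x := by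
  simp only [enorm, Pi.smul_apply, smul_eq_mul, mul_pow, ← Finset.mul_sum]
  rw [Real.sqrt_mul (sq_nonneg t), Real.sqrt_sq_eq_abs]

lemma enorm_zero {d : ℕ} : enorm (0 : Fin d → ℝ) = 0 := by simp [enorm]

lemma continuous_enorm {d : ℕ} : Continuous (enorm : (Fin d → ℝ) → ℝ) := by
  unfold enorm; fun_prop

lemma continuous_qnorm : Continuous (qnorm : G m n → ℝ) :=
  (continuous_enorm.comp continuous_fst).add
    (Real.continuous_sqrt.comp (continuous_enorm.comp continuous_snd))

lemma qnorm_nonneg (P : G m n) : 0 ≤ qnorm P :=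
  add_nonneg (enorm_nonneg _) (Real.sqrt_nonneg _)

lemma norm_fst_add_sqrt_le_qnorm (P : G m n) : ‖P.1‖ + √‖P.2‖ ≤ qnorm P :=
  add_le_add (norm_le_enorm _) (Real.sqrt_le_sqrt (norm_le_enorm _))

lemma norm_fst_le_qnorm (P : G m n) : ‖P.1‖ ≤ qnorm P :=
  (le_add_of_nonneg_right (Real.sqrt_nonneg _)).trans (norm_fst_add_sqrt_le_qnorm P)

/-- The bilinear map `(x, x') ↦ ½⟨Bx, x'⟩` of the group law. -/
def bform (b : Fin n → Matrix (Fin m) (Fin m) ℝ) :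
    (Fin m → ℝ) →L[ℝ] (Fin m → ℝ) →L[ℝ] (Fin n → ℝ) :=
  LinearMap.toContinuousBilinearMap <|
    LinearMap.mk₂ ℝ (fun x x' s => (1 / 2) * ∑ i, ∑ j, b s i j * x j * x' i)
      (fun x y z => by
        ext s
        simp only [Pi.add_apply, mul_add, add_mul, Finset.sum_add_distrib])
      (fun c x y => by
        ext s
        simp only [Pi.smul_apply, smul_eq_mul, Finset.mul_sum]
        exact Finset.sum_congr rfl fun i _ => Finset.sum_congr rfl fun j _ => by ring)
      (fun x y z => by
        ext s
        simp only [Pi.add_apply, ← mul_add, ← Finset.sum_add_distrib])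
      (fun c x y => by
        ext s
        simp only [Pi.smul_apply, smul_eq_mul, Finset.mul_sum]
        exact Finset.sum_congr rfl fun i _ => Finset.sum_congr rfl fun j _ => by ring)

lemma bform_apply (x x' : Fin m → ℝ) (s : Fin n) :
    bform b x x' s = (1 / 2) * ∑ i, ∑ j, b s i j * x j * x' i := rfl

lemma gmul_eq (P Q : G m n) : gmul b P Q = (P.1 + Q.1, P.2 + Q.2 + bform b P.1 Q.1) := rfl

lemma bform_swap (hskew : ∀ s, (b s).transpose = -(b s)) (x y : Fin m → ℝ) :
    bform b x y = -bform b y x := by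
  ext s
  rw [Pi.neg_apply, bform_apply, bform_apply, Finset.sum_comm, ← mul_neg, ← Finset.sum_neg_distrib]
  congr 1
  refine Finset.sum_congr rfl fun i _ => ?_
  rw [← Finset.sum_neg_distrib]
  refine Finset.sum_congr rfl fun j _ => ?_
  have h := congrFun (congrFun (hskew s) i) j
  simp only [Matrix.transpose_apply, Matrix.neg_apply] at h
  rw [h]; ring

lemma bform_self (hskew : ∀ s, (b s).transpose = -(b s)) (x : Fin m → ℝ) : bform b x x = 0 :=
  self_eq_neg.1 (bform_swap hskew x x)

lemma gmul_assoc (P Q R : G m n) : gmul b (gmul b P Q) R = gmul b P (gmul b Q R) := by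
  simp only [gmul_eq, map_add, add_apply]
  ext <;> simp only [Pi.add_apply] <;> ring

lemma gmul_zero (P : G m n) : gmul b P 0 = P := by simp [gmul_eq]

lemma gmul_ginv_cancel_left (hskew : ∀ s, (b s).transpose = -(b s)) (P Q : G m n) :
    gmul b P (gmul b (ginv P) Q) = Q := by
  simp only [gmul_eq, ginv, map_add, map_neg, neg_apply, bform_self hskew]
  refine Prod.ext ?_ ?_
  · simp
  · ext s
    simp
    ring

lemma ginv_gmul_cancel_left (hskew : ∀ s, (b s).transpose = -(b s)) (P Q : G m n) :
    gmul b (ginv P) (gmul b P Q) = Q := by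
  simp only [gmul_eq, ginv, map_add, map_neg, neg_apply, bform_self hskew]
  refine Prod.ext ?_ ?_
  · simp
  · ext s
    simp
    ring

lemma continuous_gmul : Continuous fun p : G m n × G m n => gmul b p.1 p.2 := by
  simp only [gmul_eq]
  fun_prop

lemma continuous_ginv : Continuous (ginv : G m n → G m n) := by
  unfold ginv; fun_prop

lemma gmul_smul (hskew : ∀ s, (b s).transpose = -(b s)) (P : G m n) (v : Fin m → ℝ) (s t : ℝ) :
    gmul b (gmul b P (t • v, 0)) ((s - t) • v, 0) = gmul b P (s • v, 0) := by
  have hv := bform_self hskew v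
  simp only [gmul_eq, map_add, map_smul, add_apply,
    smul_apply, hv]
  refine Prod.ext ?_ ?_
  · ext i; simp; ring
  · ext i; simp; ring

/-- `Reaches b ℓ P Q` says that `Q` can be joined to `P` by a polygon of horizontal segments of
total length at most `ℓ` (with respect to the sup norm on `ℝ^m`). -/
inductive Reaches (b : Fin n → Matrix (Fin m) (Fin m) ℝ) : ℝ → G m n → G m n → Prop
  | refl (P : G m n) : Reaches b 0 P P
  | step {ℓ δ : ℝ} {P Q : G m n} {v : Fin m → ℝ} (h : Reaches b ℓ P Q) (hv : ‖v‖ ≤ δ) :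
      Reaches b (ℓ + δ) P (gmul b Q (v, 0))

namespace Reaches

lemma trans {ℓ ℓ' : ℝ} {P Q R : G m n} (h : Reaches b ℓ P Q) (h' : Reaches b ℓ' Q R) :
    Reaches b (ℓ + ℓ') P R := by
  induction h' with
  | refl => simpa using h
  | step _ hv ih => rw [← add_assoc]; exact (ih h).step hv

lemma mono {ℓ ℓ' : ℝ} {P Q : G m n} (h : Reaches b ℓ P Q) (hℓ : ℓ ≤ ℓ') : Reaches b ℓ' P Q := by
  have := h.step (v := 0) (δ := ℓ' - ℓ) (by simpa using hℓ)
  rwa [add_sub_cancel, show ((0 : Fin m → ℝ), (0 : Fin n → ℝ)) = 0 from rfl, gmul_zero] at this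

end Reaches

lemma reaches_horizontal (P : G m n) (v : Fin m → ℝ) : Reaches b ‖v‖ P (gmul b P (v, 0)) := by
  simpa using (Reaches.refl P).step le_rfl

lemma reaches_commutator (hskew : ∀ s, (b s).transpose = -(b s)) (P : G m n)
    (v w : Fin m → ℝ) {δ : ℝ} (hv : ‖v‖ ≤ δ) (hw : ‖w‖ ≤ δ) :
    Reaches b (4 * δ) P (P.1, P.2 + (2 : ℝ) • bform b v w) := by
  have h := ((((Reaches.refl (b := b) P).step hv).step hw).step
    (v := -v) (δ := δ) (by simpa using hv)).step (v := -w) (δ := δ) (by simpa using hw)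
  convert h using 1
  · ring
  · have h1 := bform_self hskew v
    have h2 := bform_self hskew w
    have h3 := bform_swap hskew w v
    simp only [gmul_eq, map_add, map_neg, add_apply,
      neg_apply, h1, h2, h3]
    refine Prod.ext ?_ ?_
    · ext i; simp; ring
    · ext i; simp; ring

lemma reaches_commutator_single (hskew : ∀ s, (b s).transpose = -(b s)) (P : G m n)
    (i j : Fin m) (c : ℝ) :
    Reaches b (4 * √|c|) P (P.1, P.2 + fun s => c * b s i j) := by
  have h := reaches_commutator hskew P (v := Pi.single j (√|c|))
    (w := Pi.single i (SignType.sign c * √|c|)) (δ := √|c|)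
    (by simp [Pi.norm_single, abs_of_nonneg]) (by
      rcases lt_trichotomy c 0 with hc | rfl | hc
      · simp [sign_neg hc, Pi.norm_single, abs_of_nonneg]
      · simp
      · simp [sign_pos hc, Pi.norm_single, abs_of_nonneg])
  convert h using 3
  ext s
  have hc : (SignType.sign c : ℝ) * |c| = c := sign_mul_abs c
  have hs : √|c| * √|c| = |c| := Real.mul_self_sqrt (abs_nonneg c)
  simp only [Pi.smul_apply, bform_apply, smul_eq_mul]
  rw [Finset.sum_eq_single i, Finset.sum_eq_single j]
  · simp only [Pi.single_eq_same]
    linear_combination (-(b s i j)) * hc - b s i j * (SignType.sign c : ℝ) * hs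
  · intro j' _ hj; simp [hj]
  · simp
  · intro i' _ hi; simp [hi]
  · simp

/-- Linear independence of the matrices lets one solve `∑ c i j * b s i j = y s` linearly in `y`. -/
lemma exists_coeff (hind : LinearIndependent ℝ b) :
    ∃ c : (Fin n → ℝ) →L[ℝ] (Fin m × Fin m → ℝ),
      ∀ y s, ∑ p, c y p * b s p.1 p.2 = y s := by
  let A : Matrix (Fin n) (Fin m × Fin m) ℝ := Matrix.of fun s p => b s p.1 p.2
  have hA : LinearIndependent ℝ A.row := by
    rw [Fintype.linearIndependent_iff] at hind ⊢
    intro g hg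
    refine hind g ?_
    ext i j
    have := congrFun hg (i, j)
    simpa [A, Finset.sum_apply, Matrix.sum_apply] using this
  obtain ⟨B, hB⟩ := Matrix.mulVec_surjective_iff_exists_right_inverse.1
    (show Function.Surjective A.mulVec from by
      have h2 : A.rank = n := by simpa using hA.rank_matrix
      have h3 : LinearMap.range A.mulVecLin = ⊤ := by
        apply Submodule.eq_top_of_finrank_eq
        rw [← Matrix.rank, h2]; simp
      exact LinearMap.range_eq_top.1 h3)
  refine ⟨LinearMap.toContinuousLinearMap B.mulVecLin, fun y s => ?_⟩
  have : (A.mulVec (B.mulVec y)) s = y s := by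
    rw [Matrix.mulVec_mulVec, hB, Matrix.one_mulVec]
  rw [← this]
  simp only [A, Matrix.mulVec, dotProduct, LinearMap.coe_toContinuousLinearMap',
    Matrix.mulVecLin_apply, Matrix.of_apply]
  exact Finset.sum_congr rfl fun p _ => mul_comm _ _

/-- Every group element is reached by horizontal polygons of length controlled by the
quasi-norm. -/
lemma exists_reaches (hskew : ∀ s, (b s).transpose = -(b s)) (hind : LinearIndependent ℝ b) :
    ∃ C : ℝ, 0 ≤ C ∧ ∀ P z : G m n, Reaches b (C * qnorm z) P (gmul b P z) := by
  obtain ⟨c, hc⟩ := exists_coeff hind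
  have vert : ∀ (y : Fin n → ℝ) (P : G m n) (S : Finset (Fin m × Fin m)),
      Reaches b (∑ _p ∈ S, 4 * √(‖c‖ * ‖y‖)) P
        (P.1, P.2 + fun s => ∑ p ∈ S, c y p * b s p.1 p.2) := by
    intro y P S
    induction S using Finset.induction_on with
    | empty =>
      simp only [Finset.sum_empty]
      convert Reaches.refl P using 2
      exact add_zero _
    | insert p S hp ih =>
      have h := (reaches_commutator_single hskew
        (P.1, P.2 + fun s => ∑ p ∈ S, c y p * b s p.1 p.2) p.1 p.2 (c y p)).mono
          (ℓ' := 4 * √(‖c‖ * ‖y‖)) (by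
            gcongr
            exact (norm_le_pi_norm (c y) p).trans (c.le_opNorm y))
      convert ih.trans h using 1
      · rw [Finset.sum_insert hp, add_comm]
      · refine Prod.ext rfl ?_
        ext s
        simp only [Pi.add_apply, Finset.sum_insert hp]
        ring
  refine ⟨1 + ∑ _p : Fin m × Fin m, 4 * √‖c‖, by positivity, fun P z => ?_⟩
  have h := (reaches_horizontal (b := b) P z.1).trans
    (vert z.2 (gmul b P (z.1, 0)) Finset.univ)
  simp only [hc] at h
  convert h.mono (ℓ' := (1 + ∑ _p : Fin m × Fin m, 4 * √‖c‖) * qnorm z) ?_ using 1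
  · simp only [gmul_eq]
    refine Prod.ext rfl ?_
    ext s; simp; ring
  · have h1 := norm_fst_le_qnorm z
    have h2 : √‖z.2‖ ≤ qnorm z :=
      (le_add_of_nonneg_left (norm_nonneg _)).trans (norm_fst_add_sqrt_le_qnorm z)
    rw [add_mul, one_mul, Finset.sum_mul]
    refine add_le_add h1 (Finset.sum_le_sum fun p _ => ?_)
    rw [Real.sqrt_mul (norm_nonneg _), mul_assoc]
    gcongr

lemma qnorm_horizontal (v : Fin m → ℝ) : qnorm ((v, 0) : G m n) = enorm v := by
  simp [qnorm, enorm_zero]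

lemma C1G.hasDerivAt (hskew : ∀ s, (b s).transpose = -(b s)) {U : Set (G m n)} (hU : IsOpen U)
    {f : G m n → Fin k → ℝ} {gradf : G m n → Matrix (Fin k) (Fin m) ℝ}
    (hf : C1G m n k b U f gradf) {P : G m n} {v : Fin m → ℝ} {t : ℝ}
    (ht : gmul b P (t • v, 0) ∈ U) :
    HasDerivAt (fun s : ℝ => f (gmul b P (s • v, 0)))
      ((gradf (gmul b P (t • v, 0))).mulVec v) t := by
  rw [hasDerivAt_iff_isLittleO, Asymptotics.isLittleO_iff]
  intro c hc
  have hv1 : 0 < enorm v + 1 := add_pos_of_nonneg_of_pos (enorm_nonneg v) one_pos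
  obtain ⟨r, hr, h⟩ := hf.2.2 _ ht (c / (enorm v + 1)) (div_pos hc hv1)
  have hcont : Continuous fun s : ℝ => gmul b P (s • v, 0) :=
    continuous_gmul.comp (by fun_prop : Continuous fun s : ℝ => (P, ((s • v, 0) : G m n)))
  have hsmall : ∀ᶠ s in 𝓝 t, |s - t| * enorm v < r := by
    have : Continuous fun s : ℝ => |s - t| * enorm v := by fun_prop
    exact this.continuousAt.eventually_lt continuousAt_const (by simpa using hr)
  filter_upwards [hcont.continuousAt.preimage_mem_nhds (hU.mem_nhds ht), hsmall] with s hsU hs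
  have hq : qnorm (gmul b (ginv (gmul b P (t • v, 0))) (gmul b P (s • v, 0)))
      = |s - t| * enorm v := by
    rw [← gmul_smul hskew P v s t, ginv_gmul_cancel_left hskew, qnorm_horizontal, enorm_smul]
  have h' := h _ hsU (by rwa [hq])
  rw [hq] at h'
  refine (le_trans ?_ (norm_le_enorm _)).trans (h'.trans ?_)
  · refine le_of_eq (congrArg _ ?_)
    ext j
    simp only [Pi.sub_apply, Pi.smul_apply, smul_eq_mul, Matrix.mulVec, dotProduct, gmul_eq,
      Pi.add_apply, Finset.mul_sum]
    congr 1
    exact Finset.sum_congr rfl fun i _ => by ring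
  · rw [Real.norm_eq_abs]
    have : c / (enorm v + 1) * (|s - t| * enorm v) = c * |s - t| * (enorm v / (enorm v + 1)) := by
      field_simp
    rw [this]
    refine mul_le_of_le_one_right (by positivity) ?_
    rw [div_le_one hv1]
    linarith

lemma eventually_mulVec_sub_le {U : Set (G m n)} (hU : IsOpen U)
    {gradf : G m n → Matrix (Fin k) (Fin m) ℝ} (hg : ContinuousOn gradf U) {P₀ : G m n}
    (hP₀ : P₀ ∈ U) {ε : ℝ} (hε : 0 < ε) :
    ∀ᶠ Q in 𝓝 P₀, ∀ v, ‖(gradf Q).mulVec v - (gradf P₀).mulVec v‖ ≤ ε * ‖v‖ := by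
  have hJ : Continuous fun M : Matrix (Fin k) (Fin m) ℝ =>
      LinearMap.toContinuousLinearMap M.toLin' :=
    (LinearMap.toContinuousLinearMap.toLinearMap ∘ₗ
      (Matrix.toLin' : Matrix (Fin k) (Fin m) ℝ ≃ₗ[ℝ] _).toLinearMap
      ).continuous_of_finiteDimensional
  have h := hJ.continuousAt.comp (hg.continuousAt (hU.mem_nhds hP₀))
  filter_upwards [Metric.continuousAt_iff'.1 h ε hε] with Q hQ v
  rw [dist_eq_norm] at hQ
  refine ((LinearMap.toContinuousLinearMap (gradf Q).toLin' -
    LinearMap.toContinuousLinearMap (gradf P₀).toLin').le_opNorm v).trans ?_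
  gcongr
  exact hQ.le

/-- Mean value inequality along a horizontal segment. -/
lemma C1G.exists_segment_estimate (hskew : ∀ s, (b s).transpose = -(b s)) {U : Set (G m n)}
    (hU : IsOpen U) {f : G m n → Fin k → ℝ} {gradf : G m n → Matrix (Fin k) (Fin m) ℝ}
    (hf : C1G m n k b U f gradf) {P₀ : G m n} (hP₀ : P₀ ∈ U) {ε : ℝ} (hε : 0 < ε) :
    ∃ ρ > 0, Metric.ball P₀ ρ ⊆ U ∧ ∀ P v, P ∈ Metric.ball P₀ ρ →
      gmul b P (v, 0) ∈ Metric.ball P₀ ρ →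
      ‖f (gmul b P (v, 0)) - f P - (gradf P₀).mulVec v‖ ≤ ε * ‖v‖ := by
  obtain ⟨ρ, hρ, hball⟩ := Metric.mem_nhds_iff.1
    (inter_mem (hU.mem_nhds hP₀) (eventually_mulVec_sub_le hU hf.2.1 hP₀ hε))
  refine ⟨ρ, hρ, fun x hx => (hball hx).1, fun P v hP hPv => ?_⟩
  have hseg : ∀ t ∈ Icc (0 : ℝ) 1, gmul b P (t • v, 0) ∈ Metric.ball P₀ ρ := by
    intro t ht
    have := (convex_ball P₀ ρ).add_smul_sub_mem hP hPv ht
    convert this using 1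
    simp only [gmul_eq, map_smul]
    refine Prod.ext ?_ ?_ <;> simp
  have key := norm_image_sub_le_of_norm_deriv_le_segment_01'
    (f := fun t : ℝ => f (gmul b P (t • v, 0)) - t • (gradf P₀).mulVec v)
    (f' := fun t => (gradf (gmul b P (t • v, 0))).mulVec v - (gradf P₀).mulVec v)
    (C := ε * ‖v‖)
    (fun t ht => by
      have h1 := hf.hasDerivAt hskew hU (hball (hseg t ht)).1
      have h2 : HasDerivAt (fun s : ℝ => s • (gradf P₀).mulVec v) ((gradf P₀).mulVec v) t := by
        simpa using (hasDerivAt_id t).smul_const ((gradf P₀).mulVec v)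
      exact (h1.sub h2).hasDerivWithinAt)
    (fun t ht => (hball (hseg t (Ico_subset_Icc_self ht))).2 v)
  have h0 : gmul b P (0, 0) = P := gmul_zero P
  simp only [one_smul, zero_smul, sub_zero, h0] at key
  rwa [sub_right_comm] at key

lemma dist_gmul_horizontal_le (P : G m n) (v : Fin m → ℝ) :
    dist (gmul b P (v, 0)) P ≤ (1 + ‖bform b‖ * ‖P.1‖) * ‖v‖ := by
  have h1 : 0 ≤ ‖bform b‖ * ‖P.1‖ := by positivity
  have h2 := (bform b).le_opNorm₂ P.1 v
  have h3 := norm_nonneg v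
  rw [dist_eq_norm, gmul_eq, Prod.norm_def]
  refine max_le ?_ ?_
  · simp only [Prod.fst_sub, add_sub_cancel_left]
    nlinarith
  · simp only [Prod.snd_sub, add_zero, add_sub_cancel_left]
    nlinarith

/-- Uniform first-order expansion along horizontal polygons. -/
lemma C1G.exists_reaches_estimate (hskew : ∀ s, (b s).transpose = -(b s)) {U : Set (G m n)}
    (hU : IsOpen U) {f : G m n → Fin k → ℝ} {gradf : G m n → Matrix (Fin k) (Fin m) ℝ}
    (hf : C1G m n k b U f gradf) {P₀ : G m n} (hP₀ : P₀ ∈ U) {ε : ℝ} (hε : 0 < ε) :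
    ∃ ρ > 0, ∀ ℓ P Q, Reaches b ℓ P Q → dist P P₀ < ρ → ℓ < ρ →
      Q ∈ U ∧ ‖f Q - f P - (gradf P₀).mulVec (Q.1 - P.1)‖ ≤ ε * ℓ := by
  obtain ⟨ρ, hρ, hsub, hseg⟩ := hf.exists_segment_estimate hskew hU hP₀ hε
  set K : ℝ := 1 + ‖bform b‖ * (‖P₀.1‖ + ρ) with hK
  have hK0 : 0 < K := by positivity
  have key : ∀ ℓ P Q, Reaches b ℓ P Q → dist P P₀ + K * ℓ < ρ →
      dist Q P₀ ≤ dist P P₀ + K * ℓ ∧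
        ‖f Q - f P - (gradf P₀).mulVec (Q.1 - P.1)‖ ≤ ε * ℓ := by
    intro ℓ P Q h
    induction h with
    | refl P => intro _; simp
    | @step ℓ δ P Q v h hv ih =>
      intro hlt
      have hδ : 0 ≤ δ := (norm_nonneg v).trans hv
      rw [mul_add] at hlt ⊢
      have hKδ : 0 ≤ K * δ := by positivity
      obtain ⟨ih1, ih2⟩ := ih (by linarith)
      have hQ : dist Q P₀ < ρ := by linarith
      have hQ1 : ‖Q.1‖ ≤ ‖P₀.1‖ + ρ := by
        have h1 : ‖Q.1 - P₀.1‖ ≤ dist Q P₀ := by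
          rw [dist_eq_norm]; exact norm_fst_le (Q - P₀)
        have h2 := norm_le_norm_add_norm_sub' Q.1 P₀.1
        linarith
      have hstep : dist (gmul b Q (v, 0)) Q ≤ K * δ :=
        (dist_gmul_horizontal_le Q v).trans (by rw [hK]; gcongr)
      have hdist : dist (gmul b Q (v, 0)) P₀ ≤ dist P P₀ + (K * ℓ + K * δ) := by
        have := dist_triangle (gmul b Q (v, 0)) Q P₀
        linarith
      refine ⟨hdist, ?_⟩
      have hs := hseg Q v hQ (hdist.trans_lt hlt)
      have heq : f (gmul b Q (v, 0)) - f P - (gradf P₀).mulVec ((gmul b Q (v, 0)).1 - P.1)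
          = (f Q - f P - (gradf P₀).mulVec (Q.1 - P.1)) +
            (f (gmul b Q (v, 0)) - f Q - (gradf P₀).mulVec v) := by
        have : (gmul b Q (v, 0)).1 - P.1 = (Q.1 - P.1) + v := by
          simp only [gmul_eq]; abel
        rw [this, Matrix.mulVec_add]
        abel
      rw [heq, mul_add]
      exact (norm_add_le _ _).trans (add_le_add ih2 (hs.trans (by gcongr)))
  refine ⟨ρ / (1 + K), by positivity, fun ℓ P Q h hP hℓ => ?_⟩
  have hlt : dist P P₀ + K * ℓ < ρ := by
    have h1 : K * ℓ ≤ K * (ρ / (1 + K)) := by gcongr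
    have h2 : ρ / (1 + K) + K * (ρ / (1 + K)) = ρ := by field_simp
    linarith
  obtain ⟨h1, h2⟩ := key ℓ P Q h hlt
  exact ⟨hsub (h1.trans_lt hlt), h2⟩

/-- The inclusion `ℝ^(m-k) → ℝ^m` as the last coordinates. -/
def inclW (m k : ℕ) : (Fin (m - k) → ℝ) →L[ℝ] (Fin m → ℝ) :=
  LinearMap.toContinuousLinearMap
    { toFun := fun a j =>
        if h : (j : ℕ) < k then 0 else a ⟨(j : ℕ) - k, by have := j.isLt; omega⟩
      map_add' := fun x y => by ext j; simp only [Pi.add_apply]; split_ifs <;> simp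
      map_smul' := fun c x => by
        ext j; simp only [Pi.smul_apply, RingHom.id_apply]; split_ifs <;> simp }

/-- The inclusion `ℝ^k → ℝ^m` as the first coordinates. -/
def inclH (m k : ℕ) : (Fin k → ℝ) →L[ℝ] (Fin m → ℝ) :=
  LinearMap.toContinuousLinearMap
    { toFun := fun v j => if h : (j : ℕ) < k then v ⟨(j : ℕ), h⟩ else 0
      map_add' := fun x y => by ext j; simp only [Pi.add_apply]; split_ifs <;> simp
      map_smul' := fun c x => by
        ext j; simp only [Pi.smul_apply, RingHom.id_apply]; split_ifs <;> simp }

lemma embW_eq (A : W m n k) : embW m n k A = (inclW m k A.1, A.2) := rfl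

lemma embH_eq (v : Fin k → ℝ) : embH m n k v = (inclH m k v, 0) := rfl

lemma inclH_apply (v : Fin k → ℝ) (j : Fin m) :
    inclH m k v j = if h : (j : ℕ) < k then v ⟨(j : ℕ), h⟩ else 0 := rfl

lemma inclW_apply (a : Fin (m - k) → ℝ) (j : Fin m) : inclW m k a j =
    if h : (j : ℕ) < k then 0 else a ⟨(j : ℕ) - k, by have := j.isLt; omega⟩ := rfl

lemma inclH_castLE (hk : k ≤ m) (v : Fin k → ℝ) (i : Fin k) :
    inclH m k v (Fin.castLE hk i) = v i := by
  simp [inclH_apply]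

lemma inclW_castLE (hk : k ≤ m) (a : Fin (m - k) → ℝ) (i : Fin k) :
    inclW m k a (Fin.castLE hk i) = 0 := by
  simp [inclW_apply]

lemma inclH_add (v : Fin k → ℝ) (i : Fin (m - k)) :
    inclH m k v ⟨k + (i : ℕ), by have := i.isLt; omega⟩ = 0 := by
  simp [inclH_apply]

lemma inclW_add (a : Fin (m - k) → ℝ) (i : Fin (m - k)) :
    inclW m k a ⟨k + (i : ℕ), by have := i.isLt; omega⟩ = a i := by
  simp [inclW_apply]

lemma norm_inclH_le (v : Fin k → ℝ) : ‖inclH m k v‖ ≤ ‖v‖ := by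
  refine (pi_norm_le_iff_of_nonneg (norm_nonneg _)).2 fun j => ?_
  rw [inclH_apply]
  split_ifs
  · exact norm_le_pi_norm v _
  · simp

lemma norm_le_norm_inclW (a : Fin (m - k) → ℝ) : ‖a‖ ≤ ‖inclW m k a‖ := by
  refine (pi_norm_le_iff_of_nonneg (norm_nonneg _)).2 fun i => ?_
  rw [← inclW_add a i]
  exact norm_le_pi_norm (inclW m k a) _

lemma bform_inclH (hblock : ∀ s (i j : Fin m), (i : ℕ) < k → (j : ℕ) < k → b s i j = 0)
    (u v : Fin k → ℝ) : bform b (inclH m k u) (inclH m k v) = 0 := by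
  ext s
  rw [bform_apply, Pi.zero_apply]
  refine mul_eq_zero_of_right _ (Finset.sum_eq_zero fun i _ => Finset.sum_eq_zero fun j _ => ?_)
  by_cases hi : (i : ℕ) < k
  · by_cases hj : (j : ℕ) < k
    · rw [hblock s i j hi hj, zero_mul, zero_mul]
    · simp [inclH_apply, hj]
  · simp [inclH_apply, hi]

lemma mulVec_inclH_add_inclW (hk : k ≤ m) (gradf : G m n → Matrix (Fin k) (Fin m) ℝ)
    (Q : G m n) (v : Fin k → ℝ) (a : Fin (m - k) → ℝ) :
    (gradf Q).mulVec (inclH m k v + inclW m k a) =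
      (M1 m n k hk gradf Q).mulVec v + (M2 m n k gradf Q).mulVec a := by
  ext j
  simp only [Matrix.mulVec, dotProduct, Pi.add_apply]
  rw [← (finSumFinEquiv.trans (finCongr (Nat.add_sub_cancel' hk))).sum_comp,
    Fintype.sum_sum_type]
  have h1 : ∀ i : Fin k, (finSumFinEquiv.trans (finCongr (Nat.add_sub_cancel' hk)))
      (Sum.inl i) = Fin.castLE hk i := fun i => rfl
  have h2 : ∀ i : Fin (m - k), (finSumFinEquiv.trans (finCongr (Nat.add_sub_cancel' hk)))
      (Sum.inr i) = ⟨k + (i : ℕ), by have := i.isLt; omega⟩ := fun i => rfl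
  simp only [h1, h2, inclH_castLE, inclW_castLE, inclH_add, inclW_add, add_zero, zero_add]
  rfl

lemma continuous_embW : Continuous (embW m n k) := by
  simp only [funext embW_eq]
  fun_prop

lemma continuous_embH : Continuous (embH m n k) := by
  simp only [funext embH_eq]
  fun_prop

lemma continuous_gmul_embW_embH : Continuous fun q : W m n k × (Fin k → ℝ) =>
    gmul b (embW m n k q.1) (embH m n k q.2) :=
  continuous_gmul.comp ((continuous_embW.comp continuous_fst).prodMk
    (continuous_embH.comp continuous_snd))

lemma gmul_embH_add (hblock : ∀ s (i j : Fin m), (i : ℕ) < k → (j : ℕ) < k → b s i j = 0)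
    (P : G m n) (u v : Fin k → ℝ) :
    gmul b (gmul b P (embH m n k u)) (inclH m k (v - u), 0) = gmul b P (embH m n k v) := by
  simp only [gmul_eq, embH_eq, map_add, map_sub, add_apply, bform_inclH hblock]
  refine Prod.ext ?_ ?_
  · ext i; simp
  · ext i; simp

lemma gmul_embW_embH_injective {A B : W m n k} {u v : Fin k → ℝ} (hk : k ≤ m)
    (h : gmul b (embW m n k A) (embH m n k u) = gmul b (embW m n k B) (embH m n k v)) :
    A = B ∧ u = v := by
  simp only [gmul_eq, embW_eq, embH_eq, Prod.mk.injEq] at h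
  obtain ⟨h1, h2⟩ := h
  have hu : u = v := by
    ext i
    have := congrFun h1 (Fin.castLE hk i)
    simpa only [Pi.add_apply, inclH_castLE, inclW_castLE, zero_add] using this
  have ha : A.1 = B.1 := by
    ext i
    have := congrFun h1 ⟨k + (i : ℕ), by have := i.isLt; omega⟩
    simpa only [Pi.add_apply, inclH_add, inclW_add, add_zero] using this
  rw [hu, ha] at h2
  exact ⟨Prod.ext ha (by simpa using h2), hu⟩

/-- Points of small `qnorm` are close to the identity. -/
lemma exists_qnorm_lt_mem {s : Set (G m n)} (hs : s ∈ 𝓝 (0 : G m n)) :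
    ∃ r > 0, ∀ z, qnorm z < r → z ∈ s := by
  obtain ⟨δ, hδ, hsub⟩ := Metric.mem_nhds_iff.1 hs
  refine ⟨min 1 δ, lt_min one_pos hδ, fun z hz => hsub ?_⟩
  have h1 := norm_fst_add_sqrt_le_qnorm z
  have h2 := norm_nonneg z.1
  have h3 := Real.sqrt_nonneg ‖z.2‖
  have h4 := Real.sq_sqrt (norm_nonneg z.2)
  have h5 := min_le_left 1 δ
  have h6 := min_le_right 1 δ
  rw [mem_ball_zero_iff, Prod.norm_def]
  refine max_lt (by linarith) ?_
  nlinarith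

/-- Neighbourhoods of `(A₀, A₀)` in terms of `dW`. -/
lemma exists_dW_lt_mem (hskew : ∀ s, (b s).transpose = -(b s)) {A₀ : W m n k}
    {s : Set (W m n k × W m n k)} (hs : s ∈ 𝓝 (A₀, A₀)) :
    ∃ r > 0, ∀ A B, dW m n k b A₀ A < r → dW m n k b A B < r → (A, B) ∈ s := by
  let p : G m n → W m n k := fun P => (fun i => P.1 ⟨k + (i : ℕ), by have := i.isLt; omega⟩, P.2)
  have hp : Continuous p := by fun_prop
  have hpW : ∀ A, p (embW m n k A) = A := fun A => Prod.ext (funext fun i => inclW_add A.1 i) rfl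
  let Ψ : G m n × G m n → W m n k × W m n k := fun z =>
    (p (gmul b (embW m n k A₀) z.1), p (gmul b (gmul b (embW m n k A₀) z.1) z.2))
  have h1 : Continuous fun z : G m n × G m n => gmul b (embW m n k A₀) z.1 :=
    continuous_gmul.comp (continuous_const.prodMk continuous_fst)
  have hΨ : Continuous Ψ :=
    (hp.comp h1).prodMk (hp.comp (continuous_gmul.comp (h1.prodMk continuous_snd)))
  have hΨ0 : Ψ (0, 0) = (A₀, A₀) := by
    simp only [Ψ, gmul_zero, hpW]
  have hs' : Ψ ⁻¹' s ∈ 𝓝 ((0 : G m n), (0 : G m n)) :=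
    hΨ.continuousAt.preimage_mem_nhds (by rwa [hΨ0])
  obtain ⟨t₁, ht₁, t₂, ht₂, hsub⟩ := mem_nhds_prod_iff.1 hs'
  obtain ⟨r, hr, h⟩ := exists_qnorm_lt_mem (inter_mem ht₁ ht₂)
  refine ⟨r, hr, fun A B hA hB => ?_⟩
  have := hsub (mk_mem_prod (h _ hA).1 (h _ hB).2)
  simpa only [mem_preimage, Ψ, gmul_ginv_cancel_left hskew, hpW] using this

lemma gmul_graphMap (hskew : ∀ s, (b s).transpose = -(b s))
    (hblock : ∀ s (i j : Fin m), (i : ℕ) < k → (j : ℕ) < k → b s i j = 0)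
    (φ : W m n k → Fin k → ℝ) (A B : W m n k) :
    gmul b (gmul b (graphMap m n k b φ A)
      (gmul b (gmul b (gmul b (ginv (embH m n k (φ A))) (ginv (embW m n k A)))
        (embW m n k B)) (embH m n k (φ A)))) (inclH m k (φ B - φ A), 0)
      = graphMap m n k b φ B := by
  simp only [graphMap]
  rw [← gmul_embH_add hblock (embW m n k B) (φ A) (φ B)]
  congr 1
  simp only [gmul_assoc, gmul_ginv_cancel_left hskew]

lemma norm_sub_le_sigma (φ : W m n k → Fin k → ℝ) (A B : W m n k) :
    ‖B.1 - A.1‖ ≤ sigma m n k b φ A B := by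
  refine ((norm_le_norm_inclW _).trans (le_of_eq ?_)).trans (norm_fst_le_qnorm _)
  simp only [gmul_eq, embW_eq, embH_eq, ginv, map_sub]
  congr 1
  abel

lemma tendsto_sigma {φ : W m n k → Fin k → ℝ} {A₀ : W m n k} (hφ : ContinuousAt φ A₀)
    (hskew : ∀ s, (b s).transpose = -(b s)) :
    Tendsto (fun p : W m n k × W m n k => sigma m n k b φ p.1 p.2) (𝓝 (A₀, A₀)) (𝓝 0) := by
  have h0 : sigma m n k b φ A₀ A₀ = 0 := by
    simp only [sigma, gmul_assoc, ginv_gmul_cancel_left hskew]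
    have := ginv_gmul_cancel_left hskew (embH m n k (φ A₀)) 0
    rw [gmul_zero] at this
    rw [this]
    simp [qnorm, enorm_zero]
  rw [← h0]
  have h1 : ContinuousAt (fun p : W m n k × W m n k => φ p.1) (A₀, A₀) :=
    ContinuousAt.comp (x := (A₀, A₀)) hφ continuousAt_fst
  let F : (Fin k → ℝ) × W m n k × W m n k → ℝ := fun q =>
    qnorm (gmul b (gmul b (gmul b (ginv (embH m n k q.1)) (ginv (embW m n k q.2.1)))
      (embW m n k q.2.2)) (embH m n k q.1))
  have hF : Continuous F := by
    have hH : Continuous fun q : (Fin k → ℝ) × W m n k × W m n k => embH m n k q.1 :=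
      continuous_embH.comp continuous_fst
    have hA : Continuous fun q : (Fin k → ℝ) × W m n k × W m n k => embW m n k q.2.1 :=
      continuous_embW.comp (continuous_fst.comp continuous_snd)
    have hB : Continuous fun q : (Fin k → ℝ) × W m n k × W m n k => embW m n k q.2.2 :=
      continuous_embW.comp (continuous_snd.comp continuous_snd)
    exact continuous_qnorm.comp (continuous_gmul.comp ((continuous_gmul.comp
      ((continuous_gmul.comp ((continuous_ginv.comp hH).prodMk (continuous_ginv.comp hA))).prodMk
        hB)).prodMk hH))
  exact ContinuousAt.comp (g := F) (f := fun p : W m n k × W m n k => (φ p.1, p))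
    (x := (A₀, A₀)) hF.continuousAt (h1.prodMk continuousAt_id)

/-- Solvability of `f (i(A)·h) = 0` in `h` near `(A₀, h₀)`. -/
lemma C1G.eventually_exists_zero (hskew : ∀ s, (b s).transpose = -(b s))
    (hblock : ∀ s (i j : Fin m), (i : ℕ) < k → (j : ℕ) < k → b s i j = 0) (hk : k ≤ m)
    {U : Set (G m n)} (hU : IsOpen U) {f : G m n → Fin k → ℝ}
    {gradf : G m n → Matrix (Fin k) (Fin m) ℝ} (hf : C1G m n k b U f gradf)
    {A₀ : W m n k} {h₀ : Fin k → ℝ} (hP₀ : gmul b (embW m n k A₀) (embH m n k h₀) ∈ U)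
    (hzero : f (gmul b (embW m n k A₀) (embH m n k h₀)) = 0)
    (hM : IsUnit (M1 m n k hk gradf (gmul b (embW m n k A₀) (embH m n k h₀))))
    {δ : ℝ} (hδ : 0 < δ) :
    ∀ᶠ A in 𝓝 A₀, ∃ h ∈ Metric.closedBall h₀ δ,
      gmul b (embW m n k A) (embH m n k h) ∈ U ∧
        f (gmul b (embW m n k A) (embH m n k h)) = 0 := by
  set P₀ := gmul b (embW m n k A₀) (embH m n k h₀) with hP₀def
  set M := M1 m n k hk gradf P₀ with hMdef
  let T : (Fin k → ℝ) →L[ℝ] (Fin k → ℝ) := LinearMap.toContinuousLinearMap M.toLin'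
  let S : (Fin k → ℝ) →L[ℝ] (Fin k → ℝ) := LinearMap.toContinuousLinearMap M⁻¹.toLin'
  let R : T.NonlinearRightInverse :=
    { toFun := S
      nnnorm := ‖S‖₊ + 1
      bound' := fun y => (S.le_opNorm y).trans (by
        push_cast
        gcongr
        simp)
      right_inv' := fun y => by
        change M.mulVec (M⁻¹.mulVec y) = y
        rw [Matrix.mulVec_mulVec, Matrix.mul_nonsing_inv _ ((Matrix.isUnit_iff_isUnit_det _).1 hM),
          Matrix.one_mulVec] }
  have hR : 0 < R.nnnorm := by positivity
  set c : NNReal := R.nnnorm⁻¹ / 2 with hc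
  have hc0 : 0 < c := by positivity
  obtain ⟨ρ, hρ, hest⟩ := hf.exists_reaches_estimate hskew hU hP₀ (NNReal.coe_pos.2 hc0)
  have hnhds : ∀ᶠ q in 𝓝 (A₀, h₀),
      gmul b (embW m n k q.1) (embH m n k q.2) ∈ U ∩ Metric.ball P₀ ρ :=
    continuous_gmul_embW_embH.continuousAt.preimage_mem_nhds
      (inter_mem (hU.mem_nhds hP₀) (Metric.ball_mem_nhds _ hρ))
  rw [nhds_prod_eq] at hnhds
  obtain ⟨pA, hpA, ph, hph, hpq⟩ := Filter.eventually_prod_iff.1 hnhds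
  obtain ⟨δ₁, hδ₁, hball⟩ := Metric.nhds_basis_closedBall.mem_iff.1 hph
  set η : ℝ := min (min δ δ₁) (ρ / 4) with hη
  have hη0 : 0 < η := by positivity
  have hηδ : η ≤ δ := (min_le_left _ _).trans (min_le_left _ _)
  have hηδ₁ : η ≤ δ₁ := (min_le_left _ _).trans (min_le_right _ _)
  have hηρ : η ≤ ρ / 4 := min_le_right _ _
  have hlim : ∀ᶠ A in 𝓝 A₀,
      ‖f (gmul b (embW m n k A) (embH m n k h₀))‖ < ((R.nnnorm : ℝ)⁻¹ - c) * η := by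
    have h1 : ContinuousAt (fun A => f (gmul b (embW m n k A) (embH m n k h₀))) A₀ :=
      ContinuousAt.comp (x := A₀) (hf.1.continuousAt (hU.mem_nhds hP₀))
        (continuous_gmul_embW_embH.comp (continuous_id.prodMk continuous_const)).continuousAt
    have h2 : (0 : ℝ) < ((R.nnnorm : ℝ)⁻¹ - c) * η := by
      refine mul_pos ?_ hη0
      have : (0 : ℝ) < (R.nnnorm : ℝ)⁻¹ := by positivity
      rw [hc]
      push_cast
      linarith
    refine h1.norm.eventually_lt continuousAt_const ?_
    rw [hzero, norm_zero]
    exact h2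
  filter_upwards [hpA, hlim] with A hA hfA
  have happ : ApproximatesLinearOn (fun h => f (gmul b (embW m n k A) (embH m n k h))) T
      (Metric.closedBall h₀ η) c := by
    intro x hx y hy
    have hyP := (hpq hA (hball (Metric.closedBall_subset_closedBall hηδ₁ hy))).2
    have hreach := reaches_horizontal (b := b)
      (gmul b (embW m n k A) (embH m n k y)) (inclH m k (x - y))
    rw [gmul_embH_add hblock] at hreach
    have hxy : ‖x - y‖ < ρ := by
      rw [← dist_eq_norm]
      have := dist_triangle_right x y h₀
      rw [Metric.mem_closedBall] at hx hy
      linarith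
    have h := (hest _ _ _ hreach hyP ((norm_inclH_le _).trans_lt hxy)).2
    have hdiff : (gmul b (embW m n k A) (embH m n k x)).1 -
        (gmul b (embW m n k A) (embH m n k y)).1 = inclH m k (x - y) + inclW m k 0 := by
      simp only [gmul_eq, embH_eq, map_sub, map_zero]
      abel
    rw [hdiff, mulVec_inclH_add_inclW hk, Matrix.mulVec_zero, add_zero] at h
    exact h.trans (by gcongr; exact norm_inclH_le _)
  obtain ⟨h, hh, hfh⟩ := happ.surjOn_closedBall_of_nonlinearRightInverse R hη0.le subset_rfl
    (show (0 : Fin k → ℝ) ∈ Metric.closedBall _ _ by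
      rw [Metric.mem_closedBall, dist_zero_left]
      exact hfA.le)
  exact ⟨h, Metric.closedBall_subset_closedBall hηδ hh,
    (hpq hA (hball (Metric.closedBall_subset_closedBall hηδ₁ hh))).1, hfh⟩

/-- A function whose graph is locally a noncritical level set is continuous. -/
lemma continuousAt_of_levelSet (hskew : ∀ s, (b s).transpose = -(b s))
    (hblock : ∀ s (i j : Fin m), (i : ℕ) < k → (j : ℕ) < k → b s i j = 0) (hk : k ≤ m)
    {O : Set (W m n k)} {φ : W m n k → Fin k → ℝ} {U : Set (G m n)} (hU : IsOpen U)
    {f : G m n → Fin k → ℝ} {gradf : G m n → Matrix (Fin k) (Fin m) ℝ}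
    (hf : C1G m n k b U f gradf)
    (hgraph : ∀ P ∈ U, (P ∈ graphMap m n k b φ '' O ↔ f P = 0))
    (hM1 : ∀ Q ∈ U, IsUnit (M1 m n k hk gradf Q)) {A : W m n k} (hA : A ∈ O)
    (hAU : graphMap m n k b φ A ∈ U) : ContinuousAt φ A := by
  refine Metric.nhds_basis_closedBall.tendsto_right_iff.2 fun δ hδ => ?_
  filter_upwards [hf.eventually_exists_zero hskew hblock hk hU hAU
    ((hgraph _ hAU).1 ⟨A, hA, rfl⟩) (hM1 _ hAU) hδ] with B ⟨h, hh, hBU, hB0⟩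
  obtain ⟨B', _, hB'⟩ := (hgraph _ hBU).2 hB0
  obtain ⟨rfl, rfl⟩ := gmul_embW_embH_injective hk hB'
  exact hh

lemma continuousAt_graphMap {φ : W m n k → Fin k → ℝ} {A : W m n k} (hφ : ContinuousAt φ A) :
    ContinuousAt (graphMap m n k b φ) A := by
  exact ContinuousAt.comp (f := fun B => (B, φ B)) (x := A)
    continuous_gmul_embW_embH.continuousAt (continuousAt_id.prodMk hφ)

/-- Uniform intrinsic differentiability at a point whose graph point lies in `U`. -/
lemma uid_of_levelSet (hskew : ∀ s, (b s).transpose = -(b s)) (hind : LinearIndependent ℝ b)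
    (hblock : ∀ s (i j : Fin m), (i : ℕ) < k → (j : ℕ) < k → b s i j = 0) (hk : k ≤ m)
    {O : Set (W m n k)} {φ : W m n k → Fin k → ℝ} {U : Set (G m n)} (hU : IsOpen U)
    {f : G m n → Fin k → ℝ} {gradf : G m n → Matrix (Fin k) (Fin m) ℝ}
    (hf : C1G m n k b U f gradf)
    (hgraph : ∀ P ∈ U, (P ∈ graphMap m n k b φ '' O ↔ f P = 0)) {A₀ : W m n k}
    (hφ : ContinuousAt φ A₀) (hA₀U : graphMap m n k b φ A₀ ∈ U)
    (hM : IsUnit (M1 m n k hk gradf (graphMap m n k b φ A₀))) :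
    UID m n k b O φ A₀ (-((M1 m n k hk gradf (graphMap m n k b φ A₀))⁻¹ *
      M2 m n k gradf (graphMap m n k b φ A₀))) := by
  intro ε hε
  set P₀ := graphMap m n k b φ A₀ with hP₀
  set M := M1 m n k hk gradf P₀ with hMdef
  set N := M2 m n k gradf P₀ with hNdef
  let S : (Fin k → ℝ) →L[ℝ] (Fin k → ℝ) := LinearMap.toContinuousLinearMap M⁻¹.toLin'
  let T : (Fin (m - k) → ℝ) →L[ℝ] (Fin k → ℝ) :=
    LinearMap.toContinuousLinearMap (M⁻¹ * N).toLin'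
  obtain ⟨C, hC, hreach⟩ := exists_reaches hskew hind
  set η : ℝ := min (1 / 2) (ε / (2 * (k + 1) * (C + ‖T‖ + 1))) with hη
  have hη0 : 0 < η := by positivity
  have hη1 : η ≤ 1 / 2 := min_le_left _ _
  have hη2 : k * (2 * (η * (C + ‖T‖))) ≤ ε := by
    have h1 : η * (2 * (k + 1) * (C + ‖T‖ + 1)) ≤ ε :=
      (le_div_iff₀ (by positivity)).1 (min_le_right _ _)
    refine le_trans ?_ h1
    have h2 : (k : ℝ) * (C + ‖T‖) ≤ (k + 1) * (C + ‖T‖ + 1) :=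
      mul_le_mul (by linarith) (by linarith) (by positivity) (by positivity)
    nlinarith
  obtain ⟨ρ, hρ, hest⟩ := hf.exists_reaches_estimate hskew hU hA₀U
    (ε := η / (‖S‖ + 1)) (by positivity)
  have hfst : Tendsto (fun p : W m n k × W m n k => φ p.1) (𝓝 (A₀, A₀)) (𝓝 (φ A₀)) :=
    hφ.tendsto.comp continuousAt_fst
  have hsnd : Tendsto (fun p : W m n k × W m n k => φ p.2) (𝓝 (A₀, A₀)) (𝓝 (φ A₀)) :=
    hφ.tendsto.comp continuousAt_snd
  have hlen : ∀ᶠ p : W m n k × W m n k in 𝓝 (A₀, A₀),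
      C * sigma m n k b φ p.1 p.2 + ‖φ p.2 - φ p.1‖ < ρ := by
    have h := ((tendsto_sigma hφ hskew).const_mul C).add (hsnd.sub hfst).norm
    simp only [mul_zero, sub_self, norm_zero, add_zero] at h
    exact h.eventually_lt_const hρ
  have hΦ : Tendsto (fun p : W m n k × W m n k => graphMap m n k b φ p.1) (𝓝 (A₀, A₀))
      (𝓝 P₀) := (continuousAt_graphMap hφ).tendsto.comp continuousAt_fst
  have hnear : ∀ᶠ p : W m n k × W m n k in 𝓝 (A₀, A₀),
      graphMap m n k b φ p.1 ∈ U ∩ Metric.ball P₀ ρ :=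
    hΦ.eventually (inter_mem (hU.mem_nhds hA₀U) (Metric.ball_mem_nhds _ hρ))
  obtain ⟨r, hr, hmem⟩ := exists_dW_lt_mem hskew (hlen.and hnear)
  refine ⟨r, hr, fun A hA B hB hdA hdB _ => ?_⟩
  obtain ⟨hℓ, hAU, hAρ⟩ := hmem A B hdA hdB
  set σ := sigma m n k b φ A B with hσ
  have hpath : Reaches b (C * σ + ‖φ B - φ A‖) (graphMap m n k b φ A) (graphMap m n k b φ B) := by
    have h := (hreach (graphMap m n k b φ A) (gmul b (gmul b (gmul b (ginv (embH m n k (φ A)))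
      (ginv (embW m n k A))) (embW m n k B)) (embH m n k (φ A)))).trans
      (reaches_horizontal _ (inclH m k (φ B - φ A)))
    rw [gmul_graphMap hskew hblock] at h
    exact h.mono (add_le_add le_rfl (norm_inclH_le _))
  obtain ⟨hBU, hbound⟩ := hest _ _ _ hpath hAρ hℓ
  rw [(hgraph _ hAU).1 ⟨A, hA, rfl⟩, (hgraph _ hBU).1 ⟨B, hB, rfl⟩, sub_zero, zero_sub,
    norm_neg] at hbound
  have hdiff : (graphMap m n k b φ B).1 - (graphMap m n k b φ A).1 =
      inclH m k (φ B - φ A) + inclW m k (B.1 - A.1) := by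
    simp only [graphMap, gmul_eq, embH_eq, embW_eq, map_sub]
    abel
  rw [hdiff, mulVec_inclH_add_inclW hk] at hbound
  set D : Fin k → ℝ := (φ B - φ A) + T (B.1 - A.1) with hD
  have hDS : D = S (M.mulVec (φ B - φ A) + N.mulVec (B.1 - A.1)) := by
    change _ = M⁻¹.mulVec _
    rw [Matrix.mulVec_add, Matrix.mulVec_mulVec, Matrix.mulVec_mulVec,
      Matrix.nonsing_inv_mul _ ((Matrix.isUnit_iff_isUnit_det _).1 hM), Matrix.one_mulVec]
    rfl
  have hσ0 : 0 ≤ σ := qnorm_nonneg _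
  have ha : ‖B.1 - A.1‖ ≤ σ := norm_sub_le_sigma φ A B
  have hΔ : ‖φ B - φ A‖ ≤ ‖D‖ + ‖T‖ * σ := by
    have h1 : φ B - φ A = D - T (B.1 - A.1) := by rw [hD]; abel
    rw [h1]
    exact (norm_sub_le _ _).trans (add_le_add le_rfl ((T.le_opNorm _).trans (by gcongr)))
  have hDle : ‖D‖ ≤ η * (C * σ + ‖φ B - φ A‖) := by
    have h1 := (S.le_opNorm _).trans (mul_le_mul_of_nonneg_left hbound (norm_nonneg S))
    rw [← hDS] at h1
    refine h1.trans ?_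
    rw [← mul_assoc]
    gcongr
    rw [mul_div_left_comm]
    refine mul_le_of_le_one_right hη0.le ?_
    rw [div_le_one (by positivity)]
    linarith
  have hDfinal : ‖D‖ ≤ 2 * (η * (C + ‖T‖)) * σ := by
    have h1 : η * ‖D‖ ≤ 1 / 2 * ‖D‖ := by gcongr
    have h2 : η * (C * σ + ‖φ B - φ A‖) ≤ η * (C * σ + (‖D‖ + ‖T‖ * σ)) := by gcongr
    linarith
  have hfun : (fun j => φ B j - φ A j - ∑ i, (-(M⁻¹ * N)) j i * (B.1 i - A.1 i)) = D := by
    ext j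
    change _ = φ B j - φ A j + ∑ i, (M⁻¹ * N) j i * (B.1 i - A.1 i)
    simp only [Matrix.neg_apply, neg_mul, Finset.sum_neg_distrib, sub_neg_eq_add]
  rw [hfun]
  calc enorm D ≤ k * ‖D‖ := enorm_le_mul_norm D
    _ ≤ k * (2 * (η * (C + ‖T‖)) * σ) := by gcongr
    _ = k * (2 * (η * (C + ‖T‖))) * σ := by ring
    _ ≤ ε * σ := by gcongr

end

/-- If the intrinsic graph of `φ` is, near `Φ(A₀)`, the non-critical
zero level set of a `C¹_G` map `f` whose square horizontal block `M₁` is everywhere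
invertible, then `φ` is uniformly intrinsically differentiable in a neighbourhood
`𝒪'` of `A₀`, with intrinsic Jacobian `∇^φφ(A) = -M₁(Φ(A))⁻¹ M₂(Φ(A))`. -/
theorem statement4 (m n k : ℕ) (hm : 2 ≤ m) (hn : 1 ≤ n) (hk : 1 ≤ k) (hkm : k < m)
    (b : Fin n → Matrix (Fin m) (Fin m) ℝ)
    (hskew : ∀ s, (b s).transpose = -(b s)) (hind : LinearIndependent ℝ b)
    (hblock : ∀ s (i j : Fin m), (i : ℕ) < k → (j : ℕ) < k → b s i j = 0)
    (O : Set (W m n k)) (hO : IsOpen O) (φ : W m n k → Fin k → ℝ)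
    (A₀ : W m n k) (hA₀ : A₀ ∈ O)
    (U : Set (G m n)) (hU : IsOpen U) (hΦU : graphMap m n k b φ A₀ ∈ U)
    (f : G m n → Fin k → ℝ) (gradf : G m n → Matrix (Fin k) (Fin m) ℝ)
    (hf : C1G m n k b U f gradf)
    (hgraph : ∀ P ∈ U, (P ∈ graphMap m n k b φ '' O ↔ f P = 0))
    (hM1 : ∀ Q ∈ U, IsUnit (M1 m n k hkm.le gradf Q)) :
    ∃ O' : Set (W m n k), O' ⊆ O ∧ IsOpen O' ∧ A₀ ∈ O' ∧
      ∀ A ∈ O', UID m n k b O φ A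
        (-((M1 m n k hkm.le gradf (graphMap m n k b φ A))⁻¹ *
            M2 m n k gradf (graphMap m n k b φ A))) := by
  refine ⟨interior {A ∈ O | graphMap m n k b φ A ∈ U}, fun A hA => (interior_subset hA).1,
    isOpen_interior, ?_, fun A hA => ?_⟩
  · have hφ := continuousAt_of_levelSet hskew hblock hkm.le hU hf hgraph hM1 hA₀ hΦU
    exact mem_interior_iff_mem_nhds.2 (inter_mem (hO.mem_nhds hA₀)
      ((continuousAt_graphMap hφ).preimage_mem_nhds (hU.mem_nhds hΦU)))
  · obtain ⟨hAO, hAU⟩ := interior_subset hA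
    exact uid_of_levelSet hskew hind hblock hkm.le hU hf hgraph
      (continuousAt_of_levelSet hskew hblock hkm.le hU hf hgraph hM1 hAO hAU) hAU (hM1 _ hAU)

end Carnot
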